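/- arXiv:1107.0446 — 3 statements merged into one kernel-verified Lean document; each statement's English description precedes it below -/
import Mathlib

section
/- Let R = R₁ × R₂ be a product of two commutative rings, n a nonnegative integer, and suppose every R-module M admits a short exact sequence 0 → M → P → M → 0 of R-modules with pd_R(P) ≤ n. Then every R₁-module N admits a short exact sequence 0 → N → Q → N → 0 of R₁-modules with pd_{R₁}(Q) ≤ n. -/
universe u

/-- Projective dimension of the module `M` is at most `n`. -/
def pdLE (R : Type u) [CommRing R] : ℕ → (M : Type u) → [AddCommGroup M] → [Module R M] → Prop
  | 0, M, _, _ => Module.Projective R M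
  | n+1, M, _, _ => ∃ (P : Type u) (_ : AddCommGroup P) (_ : Module R P) (f : P →ₗ[R] M),
      Module.Projective R P ∧ Function.Surjective f ∧ pdLE R n (LinearMap.ker f)

/-- The `R₁`-component `(1,0) • P` of an `R₁ × R₂`-module, as a submodule. -/
def eSub (R₁ R₂ : Type u) [CommRing R₁] [CommRing R₂] (P : Type u) [AddCommGroup P]
    [Module (R₁ × R₂) P] : Submodule (R₁ × R₂) P where
  carrier := {x | ((1, 0) : R₁ × R₂) • x = x}
  add_mem' := by
    intro a b ha hb
    simp only [Set.mem_ofPred_eq] at *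
    rw [smul_add, ha, hb]
  zero_mem' := by simp
  smul_mem' := by
    intro c x hx
    simp only [Set.mem_ofPred_eq] at *
    rw [smul_comm, hx]

/-- The `R₁`-component as a type. -/
def EPart (R₁ R₂ : Type u) [CommRing R₁] [CommRing R₂] (P : Type u) [AddCommGroup P]
    [Module (R₁ × R₂) P] : Type u := eSub R₁ R₂ P

section
variable {R₁ R₂ : Type u} [CommRing R₁] [CommRing R₂] {P : Type u} [AddCommGroup P]
    [Module (R₁ × R₂) P]

instance : AddCommGroup (EPart R₁ R₂ P) := inferInstanceAs (AddCommGroup (eSub R₁ R₂ P))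

/-- Inclusion of the component. -/
def EPart.val : EPart R₁ R₂ P →+ P := (eSub R₁ R₂ P).subtype.toAddMonoidHom

theorem EPart.val_inj : Function.Injective (EPart.val : EPart R₁ R₂ P →+ P) :=
  Subtype.val_injective

/-- Constructor for the component. -/
def EPart.mk (x : P) (hx : ((1, 0) : R₁ × R₂) • x = x) : EPart R₁ R₂ P := ⟨x, hx⟩

theorem EPart.val_mk (x : P) (hx : ((1, 0) : R₁ × R₂) • x = x) :
    EPart.val (EPart.mk x hx) = x := rfl

theorem EPart.val_prop (x : EPart R₁ R₂ P) : ((1, 0) : R₁ × R₂) • EPart.val x = EPart.val x :=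
  x.2

instance : SMul R₁ (EPart R₁ R₂ P) where
  smul a x := EPart.mk (((a, 0) : R₁ × R₂) • EPart.val x) (by rw [smul_smul]; simp)

theorem EPart.val_smul (a : R₁) (x : EPart R₁ R₂ P) :
    EPart.val (a • x) = ((a, 0) : R₁ × R₂) • EPart.val x := rfl

instance : Module R₁ (EPart R₁ R₂ P) where
  one_smul x := EPart.val_inj (by rw [EPart.val_smul, EPart.val_prop])
  mul_smul a b x := EPart.val_inj (by simp only [EPart.val_smul, smul_smul]; simp)
  smul_zero a := EPart.val_inj (by simp only [EPart.val_smul, map_zero, smul_zero])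
  smul_add a x y := EPart.val_inj (by simp only [EPart.val_smul, map_add, smul_add])
  add_smul a b x := EPart.val_inj (by
    simp only [EPart.val_smul, map_add, ← add_smul]; simp)
  zero_smul x := EPart.val_inj (by
    rw [EPart.val_smul, map_zero]; exact zero_smul (R₁ × R₂) _)

end

/-- `Q` is (isomorphic to) the `R₁`-component of `P`. -/
structure IsEPart (R₁ R₂ : Type u) [CommRing R₁] [CommRing R₂] (P Q : Type u) [AddCommGroup P]
    [Module (R₁ × R₂) P] [AddCommGroup Q] [Module R₁ Q] where
  s : Q →+ P
  r : P →+ Q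
  rs : ∀ q, r (s q) = q
  sr : ∀ p, s (r p) = ((1, 0) : R₁ × R₂) • p
  s_smul : ∀ (a : R₁) q, s (a • q) = ((a, 0) : R₁ × R₂) • s q

section
variable {R₁ R₂ : Type u} [CommRing R₁] [CommRing R₂] {P Q : Type u} [AddCommGroup P]
    [Module (R₁ × R₂) P] [AddCommGroup Q] [Module R₁ Q]

theorem IsEPart.r_smul (E : IsEPart R₁ R₂ P Q) (c : R₁ × R₂) (p : P) :
    E.r (c • p) = c.1 • E.r p := by
  apply Function.LeftInverse.injective E.rs
  rw [E.sr, E.s_smul, E.sr, smul_smul, smul_smul]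
  congr 1
  ext <;> simp

theorem IsEPart.e_s (E : IsEPart R₁ R₂ P Q) (q : Q) :
    ((1, 0) : R₁ × R₂) • E.s q = E.s q := by
  rw [← E.s_smul, one_smul]

/-- The standard component. -/
def EPart.isEPart : IsEPart R₁ R₂ P (EPart R₁ R₂ P) where
  s := EPart.val
  r := 
    { toFun := fun p => EPart.mk (((1, 0) : R₁ × R₂) • p) (by rw [smul_smul]; simp)
      map_zero' := EPart.val_inj (by simp [EPart.val_mk])
      map_add' := fun x y => EPart.val_inj (by simp [EPart.val_mk]) }
  rs q := EPart.val_inj (EPart.val_prop q)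
  sr p := rfl
  s_smul a q := rfl

theorem IsEPart.projective (E : IsEPart R₁ R₂ P Q) [Module.Projective (R₁ × R₂) P] :
    Module.Projective R₁ Q := by
  refine Module.Projective.of_lifting_property'' fun f hf => ?_
  letI : Module (R₁ × R₂) Q := Module.compHom Q (RingHom.fst R₁ R₂)
  letI : Module (R₁ × R₂) (Q →₀ R₁) := Module.compHom (Q →₀ R₁) (RingHom.fst R₁ R₂)
  let f' : (Q →₀ R₁) →ₗ[R₁ × R₂] Q :=
    { toFun := f, map_add' := f.map_add, map_smul' := fun c x => f.map_smul c.1 x }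
  let r' : P →ₗ[R₁ × R₂] Q :=
    { toFun := E.r, map_add' := E.r.map_add, map_smul' := fun c x => E.r_smul c x }
  obtain ⟨g, hg⟩ := Module.projective_lifting_property f' r' hf
  refine ⟨{ toFun := fun q => g (E.s q), map_add' := by simp, map_smul' := ?_ }, ?_⟩
  · intro a q
    rw [E.s_smul, g.map_smul]
    rfl
  · ext q
    exact (LinearMap.congr_fun hg (E.s q)).trans (E.rs q)

end

theorem IsEPart.pdLE_of {R₁ R₂ : Type u} [CommRing R₁] [CommRing R₂] (n : ℕ) :
    ∀ {P Q : Type u} [AddCommGroup P] [Module (R₁ × R₂) P] [AddCommGroup Q] [Module R₁ Q]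
      (_ : IsEPart R₁ R₂ P Q), pdLE (R₁ × R₂) n P → pdLE R₁ n Q := by
  induction n with
  | zero =>
    intro P Q _ _ _ _ E hP
    haveI : Module.Projective (R₁ × R₂) P := hP
    exact E.projective
  | succ n ih =>
    intro P Q _ _ _ _ E hP
    obtain ⟨P', _, _, f, hproj, hf, hk⟩ := hP
    let g : EPart R₁ R₂ P' →ₗ[R₁] Q :=
      { toFun := fun x => E.r (f (EPart.val x))
        map_add' := by simp
        map_smul' := fun a x => by
          rw [EPart.val_smul, f.map_smul, E.r_smul]; rfl }
    have hker : ∀ x : EPart R₁ R₂ P', g x = 0 → f (EPart.val x) = 0 := by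
      intro x hx
      have : E.s (E.r (f (EPart.val x))) = 0 := by
        rw [show E.r (f (EPart.val x)) = 0 from hx, map_zero]
      rwa [E.sr, ← f.map_smul, EPart.val_prop] at this
    refine ⟨EPart R₁ R₂ P', inferInstance, inferInstance, g, EPart.isEPart.projective, ?_, ?_⟩
    · intro q
      obtain ⟨p, hp⟩ := hf (E.s q)
      refine ⟨EPart.isEPart.r p, ?_⟩
      change E.r (f (((1, 0) : R₁ × R₂) • p)) = q
      rw [f.map_smul, hp, E.e_s, E.rs]
    · refine ih (P := LinearMap.ker f) (Q := LinearMap.ker g) ?_ hk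
      refine
        { s := 
            { toFun := fun x => ⟨EPart.val x.1, hker x.1 x.2⟩
              map_zero' := by ext; simp
              map_add' := fun x y => by ext; simp }
          r := 
            { toFun := fun y => ⟨EPart.isEPart.r y.1, by
                change E.r (f (((1, 0) : R₁ × R₂) • y.1)) = 0
                rw [f.map_smul, show f y.1 = 0 from y.2, smul_zero, map_zero]⟩
              map_zero' := by ext; simp
              map_add' := fun x y => by ext; simp }
          rs := fun q => Subtype.ext (EPart.isEPart.rs q.1)
          sr := fun p => rfl
          s_smul := fun a q => rfl }

/-- If every module over `R = R₁ × R₂` fits in a short exact sequence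
`0 → M → P → M → 0` with `pd_R P ≤ n`, then every `R₁`-module fits in such a
sequence over `R₁`. -/
theorem stmt7 (R₁ R₂ : Type u) [CommRing R₁] [CommRing R₂] (n : ℕ)
    (h : ∀ (M : Type u) [AddCommGroup M] [Module (R₁ × R₂) M],
      ∃ (P : Type u) (_ : AddCommGroup P) (_ : Module (R₁ × R₂) P)
        (i : M →ₗ[R₁ × R₂] P) (p : P →ₗ[R₁ × R₂] M),
        Function.Injective i ∧ Function.Surjective p ∧ Function.Exact i p ∧
          pdLE (R₁ × R₂) n P) :
    ∀ (N : Type u) [AddCommGroup N] [Module R₁ N],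
      ∃ (Q : Type u) (_ : AddCommGroup Q) (_ : Module R₁ Q)
        (i : N →ₗ[R₁] Q) (p : Q →ₗ[R₁] N),
        Function.Injective i ∧ Function.Surjective p ∧ Function.Exact i p ∧
          pdLE R₁ n Q := by
  intro N _ _
  letI : Module (R₁ × R₂) N := Module.compHom N (RingHom.fst R₁ R₂)
  have hsm : ∀ (c : R₁ × R₂) (x : N), c • x = c.1 • x := fun _ _ => rfl
  obtain ⟨P, _, _, i, p, hi, hp, hip, hpd⟩ := h N
  refine ⟨EPart R₁ R₂ P, inferInstance, inferInstance,
    { toFun := fun x => EPart.mk (i x) (by rw [← i.map_smul, hsm, one_smul])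
      map_add' := fun x y => EPart.val_inj (by simp [EPart.val_mk])
      map_smul' := fun a x => EPart.val_inj ?_ },
    { toFun := fun y => p (EPart.val y)
      map_add' := by simp
      map_smul' := fun a y => ?_ }, ?_, ?_, ?_, IsEPart.pdLE_of n EPart.isEPart hpd⟩
  · rw [EPart.val_smul, EPart.val_mk, EPart.val_mk, ← i.map_smul, hsm]
    rfl
  · rw [EPart.val_smul, p.map_smul, hsm]
    rfl
  · intro x y hxy
    exact hi (congrArg EPart.val hxy)
  · intro x
    obtain ⟨y, hy⟩ := hp x
    refine ⟨EPart.isEPart.r y, ?_⟩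
    change p (((1, 0) : R₁ × R₂) • y) = x
    rw [p.map_smul, hy, hsm, one_smul]
  · intro y
    constructor
    · intro hy
      obtain ⟨x, hx⟩ := (hip (EPart.val y)).1 hy
      exact ⟨x, EPart.val_inj hx⟩
    · rintro ⟨x, rfl⟩
      exact (hip (i x)).2 ⟨x, rfl⟩
end

section
/- Let R be a commutative ring, R[X] the polynomial ring, and M an R-module. If the R[X]-module M[X] = M ⊗_R R[X] admits a short exact sequence 0 → M[X] → P → M[X] → 0 of R[X]-modules with pd_{R[X]}(P) ≤ m, then M admits a short exact sequence 0 → M → Q → M → 0 of R-modules with pd_R(Q) ≤ m, obtained by applying − ⊗_{R[X]} R. -/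
universe u
open TensorProduct Polynomial

open scoped Pointwise

theorem pdLE_congr (R : Type u) [CommRing R] (n : ℕ) (M N : Type u)
    [AddCommGroup M] [Module R M] [AddCommGroup N] [Module R N] (e : M ≃ₗ[R] N)
    (h : pdLE R n M) : pdLE R n N := by
  cases n with
  | zero =>
    have h' : Module.Projective R M := h
    exact (Module.Projective.of_equiv e : Module.Projective R N)
  | succ n =>
    obtain ⟨P, _, _, f, hP, hf, hk⟩ := h
    refine ⟨P, _, _, e.toLinearMap ∘ₗ f, hP, e.surjective.comp hf, ?_⟩
    rw [LinearEquiv.ker_comp]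
    exact hk

theorem quot_map_injective {S : Type*} [CommRing S] (x : S) {A B D : Type*}
    [AddCommGroup A] [Module S A] [AddCommGroup B] [Module S B] [AddCommGroup D] [Module S D]
    (i : A →ₗ[S] B) (p : B →ₗ[S] D) (hi : Function.Injective i) (hip : Function.Exact i p)
    (hD : IsSMulRegular D x) : Function.Injective (QuotSMulTop.map x i) := by
  rw [injective_iff_map_eq_zero]
  intro a
  obtain ⟨a, rfl⟩ := Submodule.Quotient.mk_surjective _ a
  intro h
  rw [QuotSMulTop.map_apply_mk, Submodule.Quotient.mk_eq_zero,
    Submodule.mem_smul_pointwise_iff_exists] at h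
  obtain ⟨b, -, hb⟩ := h
  have hpb : p b = 0 := by
    apply hD.right_eq_zero_of_smul
    rw [← map_smul, hb]
    exact hip.apply_apply_eq_zero a
  obtain ⟨c, rfl⟩ := (hip b).1 hpb
  rw [← map_smul] at hb
  rw [Submodule.Quotient.mk_eq_zero, ← hi hb]
  exact Submodule.smul_mem_pointwise_smul _ _ _ trivial

theorem X_regular_of_projective (R : Type u) [CommRing R] (P : Type u) [AddCommGroup P]
    [Module R[X] P] [Module.Projective R[X] P] : IsSMulRegular P (X : R[X]) :=
  Module.Flat.isSMulRegular_of_nonZeroDivisors (Polynomial.monic_X.mem_nonZeroDivisors)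

theorem mk_poly_smul (R : Type u) [CommRing R] (P : Type u) [AddCommGroup P]
    [Module R[X] P] [Module R P] [IsScalarTower R R[X] P] (f : R[X]) (y : P) :
    (Submodule.Quotient.mk (f • y) : QuotSMulTop (X : R[X]) P) =
      f.coeff 0 • (Submodule.Quotient.mk y : QuotSMulTop (X : R[X]) P) := by
  rw [← Submodule.Quotient.mk_smul, Submodule.Quotient.eq]
  have : f • y - f.coeff 0 • y = (X : R[X]) • (f.divX • y) := by
    have h1 : f.coeff 0 • y = C (f.coeff 0) • y := (algebraMap_smul R[X] (f.coeff 0) y).symm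
    rw [h1, smul_smul, sub_eq_iff_eq_add, ← add_smul, X_mul_divX_add]
  rw [this]
  exact Submodule.smul_mem_pointwise_smul _ _ _ trivial

theorem quot_projective (R : Type u) [CommRing R] (P : Type u) [AddCommGroup P]
    [Module R[X] P] [Module R P] [IsScalarTower R R[X] P] [Module.Projective R[X] P] :
    Module.Projective R (QuotSMulTop (X : R[X]) P) := by
  obtain ⟨s, hs⟩ := Module.projective_def'.1 (inferInstance : Module.Projective R[X] P)
  let g : P →ₗ[R] (P →₀ R) := Finsupp.mapRange.linearMap (lcoeff R 0) ∘ₗ s.restrictScalars R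
  let g' : QuotSMulTop (X : R[X]) P →ₗ[R] (P →₀ R) :=
    Submodule.liftQ (((X : R[X]) • (⊤ : Submodule R[X] P)).restrictScalars R) g (by
      intro y hy
      obtain ⟨z, -, rfl⟩ := (Submodule.mem_smul_pointwise_iff_exists _ _ _).1 hy
      rw [LinearMap.mem_ker]
      ext q
      simp [g]) ∘ₗ (Submodule.Quotient.restrictScalarsEquiv R
        ((X : R[X]) • (⊤ : Submodule R[X] P))).symm.toLinearMap
  let q : (P →₀ R) →ₗ[R] QuotSMulTop (X : R[X]) P :=
    Finsupp.linearCombination R (fun y => Submodule.Quotient.mk y)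
  refine Module.Projective.of_split g' q ?_
  have key : ∀ t : P →₀ R[X], q (Finsupp.mapRange.linearMap (lcoeff R 0) t) =
      Submodule.Quotient.mk (Finsupp.linearCombination R[X] id t) := by
    intro t
    induction t using Finsupp.induction_linear with
    | zero => simp
    | add a b ha hb => rw [map_add, map_add, ha, hb, map_add, Submodule.Quotient.mk_add]
    | single y f => simp [q, mk_poly_smul R P]
  refine LinearMap.ext fun y => ?_
  obtain ⟨y, rfl⟩ := Submodule.Quotient.mk_surjective _ y
  have hg : g' (Submodule.Quotient.mk y) = Finsupp.mapRange.linearMap (lcoeff R 0) (s y) := rfl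
  rw [LinearMap.comp_apply, hg]
  refine (key (s y)).trans ?_
  have := LinearMap.congr_fun hs y
  exact congrArg _ this

theorem quot_pdLE (R : Type u) [CommRing R] (n : ℕ) : ∀ (P : Type u) [AddCommGroup P]
    [Module R[X] P] [Module R P] [IsScalarTower R R[X] P], IsSMulRegular P (X : R[X]) →
    pdLE R[X] n P → pdLE R n (QuotSMulTop (X : R[X]) P) := by
  induction n with
  | zero =>
    intro P _ _ _ _ _ h
    have : Module.Projective R[X] P := h
    exact quot_projective R P
  | succ n ih =>
    rintro P _ _ _ _ hreg ⟨F, _, _, f, hF, hf, hk⟩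
    letI : Module R F := Module.compHom F (algebraMap R R[X])
    haveI : IsScalarTower R R[X] F := IsScalarTower.of_algebraMap_smul fun _ _ => rfl
    have hex : Function.Exact (LinearMap.ker f).subtype f := LinearMap.exact_subtype_ker_map f
    have hK := ih (LinearMap.ker f) ((X_regular_of_projective R F).submodule _ _) hk
    let F' := (QuotSMulTop.map (X : R[X]) f).restrictScalars R
    let K' := (QuotSMulTop.map (X : R[X]) (LinearMap.ker f).subtype).restrictScalars R
    have hK' : Function.Injective K' :=
      quot_map_injective X _ f (Submodule.injective_subtype _) hex hreg
    have hex' : Function.Exact K' F' := QuotSMulTop.map_exact X hex hf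
    refine ⟨QuotSMulTop (X : R[X]) F, _, _, F', quot_projective R F,
      QuotSMulTop.map_surjective X hf, ?_⟩
    refine pdLE_congr R n _ _ ?_ hK
    exact (LinearEquiv.ofInjective K' hK').trans
      (LinearEquiv.ofEq _ _ (LinearMap.exact_iff.1 hex').symm)

theorem X_regular_tensor (R : Type u) [CommRing R] (M : Type u) [AddCommGroup M] [Module R M] :
    IsSMulRegular (R[X] ⊗[R] M) (X : R[X]) := by
  let d : R[X] →ₗ[R] R[X] :=
    { toFun := divX
      map_add' := fun _ _ => divX_add
      map_smul' := fun r f => by simp [smul_eq_C_mul, divX_C_mul] }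
  have : Function.LeftInverse (d.rTensor M) (fun t => (X : R[X]) • t) := by
    intro t
    induction t using TensorProduct.induction_on with
    | zero => simp
    | add a b ha hb =>
      simp only [smul_add, map_add] at *
      rw [ha, hb]
    | tmul f m =>
      have : divX (X * f) = f := by ext k; simp [coeff_divX]
      simp [TensorProduct.smul_tmul', d, this]
  exact this.injective

noncomputable def quotTensorEquiv (R : Type u) [CommRing R] (M : Type u) [AddCommGroup M]
    [Module R M] : M ≃ₗ[R] QuotSMulTop (X : R[X]) (R[X] ⊗[R] M) :=
  LinearEquiv.ofBijective
    (((X • (⊤ : Submodule R[X] (R[X] ⊗[R] M))).mkQ.restrictScalars R) ∘ₗ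
      TensorProduct.mk R R[X] M 1) (by
    constructor
    · rw [injective_iff_map_eq_zero]
      intro m hm
      obtain ⟨t, -, ht⟩ := (Submodule.mem_smul_pointwise_iff_exists _ _ _).1
        ((Submodule.Quotient.mk_eq_zero _).1 hm)
      let e : R[X] ⊗[R] M →ₗ[R] M :=
        (TensorProduct.lid R M).toLinearMap ∘ₗ (lcoeff R 0).rTensor M
      have h0 : ∀ t, e ((X : R[X]) • t) = 0 := by
        intro t
        induction t using TensorProduct.induction_on with
        | zero => simp
        | add a b ha hb => rw [smul_add, map_add, ha, hb, add_zero]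
        | tmul f m => simp [TensorProduct.smul_tmul', e]
      have h1 := h0 t
      rw [ht] at h1
      simpa [e] using h1
    · intro y
      obtain ⟨t, rfl⟩ := Submodule.Quotient.mk_surjective _ y
      induction t using TensorProduct.induction_on with
      | zero => exact ⟨0, by simp⟩
      | add a b ha hb =>
        obtain ⟨a', ha⟩ := ha
        obtain ⟨b', hb⟩ := hb
        exact ⟨a' + b', by rw [map_add, ha, hb, Submodule.Quotient.mk_add]⟩
      | tmul f m =>
        refine ⟨f.coeff 0 • m, ?_⟩
        rw [map_smul]
        have := mk_poly_smul R (R[X] ⊗[R] M) f (1 ⊗ₜ m)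
        rw [TensorProduct.smul_tmul', smul_eq_mul, mul_one] at this
        exact this.symm)

/-- If the `R[X]`-module `M[X] = R[X] ⊗_R M` fits in a short exact
sequence `0 → M[X] → P → M[X] → 0` of `R[X]`-modules with `pd_{R[X]} P ≤ m`, then
`M` fits in a short exact sequence `0 → M → Q → M → 0` of `R`-modules with
`pd_R Q ≤ m`. -/
theorem stmt8 (R : Type u) [CommRing R] (m : ℕ)
    (M : Type u) [AddCommGroup M] [Module R M]
    (h : ∃ (P : Type u) (_ : AddCommGroup P) (_ : Module (Polynomial R) P)
      (i : (Polynomial R ⊗[R] M) →ₗ[Polynomial R] P)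
      (p : P →ₗ[Polynomial R] (Polynomial R ⊗[R] M)),
      Function.Injective i ∧ Function.Surjective p ∧ Function.Exact i p ∧
        pdLE (Polynomial R) m P) :
    ∃ (Q : Type u) (_ : AddCommGroup Q) (_ : Module R Q)
      (i : M →ₗ[R] Q) (p : Q →ₗ[R] M),
      Function.Injective i ∧ Function.Surjective p ∧ Function.Exact i p ∧ pdLE R m Q := by
  obtain ⟨P, _, _, i, p, hi, hp, hip, hP⟩ := h
  letI : Module R P := Module.compHom P (algebraMap R R[X])
  haveI : IsScalarTower R R[X] P := IsScalarTower.of_algebraMap_smul fun _ _ => rfl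
  have hT := X_regular_tensor R M
  have hreg : IsSMulRegular P (X : R[X]) :=
    isSMulRegular_of_range_eq_ker hi (LinearMap.exact_iff.1 hip).symm hT hT
  let e := quotTensorEquiv R M
  let i' := (QuotSMulTop.map (X : R[X]) i).restrictScalars R
  let p' := (QuotSMulTop.map (X : R[X]) p).restrictScalars R
  have hi' : Function.Injective i' := quot_map_injective X i p hi hip hT
  have hp' : Function.Surjective p' := QuotSMulTop.map_surjective X hp
  have hip' : Function.Exact i' p' := QuotSMulTop.map_exact X hip hp
  refine ⟨QuotSMulTop (X : R[X]) P, inferInstance, inferInstance, i' ∘ₗ e.toLinearMap,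
    e.symm.toLinearMap ∘ₗ p', hi'.comp e.injective, e.symm.surjective.comp hp', ?_,
    quot_pdLE R m P hreg hP⟩
  intro y
  have := hip' y
  simp only [LinearMap.comp_apply, LinearEquiv.coe_coe, LinearEquiv.map_eq_zero_iff, this,
    Set.mem_range]
  constructor
  · rintro ⟨t, rfl⟩
    exact ⟨e.symm t, by simp⟩
  · rintro ⟨t, rfl⟩
    exact ⟨e t, rfl⟩
end

section
/- Let R be a commutative ring, n a nonnegative integer, and M an R-module admitting a short exact sequence 0 → M → P → M → 0 with pd_R(P) ≤ n. If additionally pd_R(M) < ∞, then pd_R(M) ≤ n. -/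
universe u

open CategoryTheory in
theorem shortExact_aux (R : Type u) [CommRing R] (A B C : Type u)
    [AddCommGroup A] [Module R A] [AddCommGroup B] [Module R B] [AddCommGroup C] [Module R C]
    (i : A →ₗ[R] B) (p : B →ₗ[R] C)
    (hi : Function.Injective i) (hp : Function.Surjective p) (hex : Function.Exact i p) :
    ∃ h : ModuleCat.ofHom i ≫ ModuleCat.ofHom p = 0,
      (ShortComplex.mk (ModuleCat.ofHom i) (ModuleCat.ofHom p) h).ShortExact := by
  have h : ModuleCat.ofHom i ≫ ModuleCat.ofHom p = 0 := by
    ext x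
    exact hex.apply_apply_eq_zero x
  refine ⟨h, ?_⟩
  exact
    { exact := (ShortComplex.ShortExact.moduleCat_exact_iff_function_exact _).2 hex
      mono_f := (ModuleCat.mono_iff_injective _).2 hi
      epi_g := (ModuleCat.epi_iff_surjective _).2 hp }

open CategoryTheory in
theorem pdLE_iff_aux (R : Type u) [CommRing R] (n : ℕ) :
    ∀ (M : Type u) [AddCommGroup M] [Module R M],
      pdLE R n M ↔ HasProjectiveDimensionLT (ModuleCat.of R M) (n + 1) := by
  induction n with
  | zero =>
    intro M _ _
    rw [← projective_iff_hasProjectiveDimensionLT_one, pdLE]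
    exact IsProjective.iff_projective M
  | succ n ih =>
    intro M _ _
    have key : ∀ (P : Type u) [AddCommGroup P] [Module R P] (f : P →ₗ[R] M),
        Module.Projective R P → Function.Surjective f →
        (HasProjectiveDimensionLT (ModuleCat.of R M) (n + 2) ↔ pdLE R n (LinearMap.ker f)) := by
      intro P _ _ f hP hf
      obtain ⟨h, hS⟩ := shortExact_aux R _ _ _ (LinearMap.ker f).subtype f
        (Submodule.injective_subtype _) hf (LinearMap.exact_subtype_ker_map f)
      rw [ih]
      exact hS.hasProjectiveDimensionLT_X₃_iff n ((IsProjective.iff_projective P).1 hP)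
    rw [pdLE]
    constructor
    · rintro ⟨P, _, _, f, hP, hf, hk⟩
      exact (key P f hP hf).2 hk
    · intro hM
      have hs := Finsupp.linearCombination_id_surjective R M
      exact ⟨M →₀ R, inferInstance, inferInstance, Finsupp.linearCombination R id,
        inferInstance, hs, (key _ _ inferInstance hs).1 hM⟩

/-- If `M` fits in a short exact sequence `0 → M → P → M → 0` with
`pd_R P ≤ n`, and `pd_R M` is finite, then `pd_R M ≤ n`. -/
theorem stmt15 (R : Type u) [CommRing R] (n : ℕ)
    (M : Type u) [AddCommGroup M] [Module R M]
    (P : Type u) [AddCommGroup P] [Module R P]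
    (i : M →ₗ[R] P) (p : P →ₗ[R] M)
    (hi : Function.Injective i) (hp : Function.Surjective p) (hex : Function.Exact i p)
    (hP : pdLE R n P)
    (hfin : ∃ d : ℕ, pdLE R d M) :
    pdLE R n M := by
  obtain ⟨d, hd⟩ := hfin
  obtain ⟨h, hS⟩ := shortExact_aux R _ _ _ i p hi hp hex
  rw [pdLE_iff_aux] at hP hd ⊢
  have main : ∀ k : ℕ, CategoryTheory.HasProjectiveDimensionLT (ModuleCat.of R M) (n + 1 + k) →
      CategoryTheory.HasProjectiveDimensionLT (ModuleCat.of R M) (n + 1) := by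
    intro k
    induction k with
    | zero => exact id
    | succ k ih =>
      intro hk
      exact ih (hS.hasProjectiveDimensionLT_X₁ (n + 1 + k)
        (CategoryTheory.hasProjectiveDimensionLT_of_ge _ (n + 1) _ (by omega)) hk)
  exact main (d + 1) (CategoryTheory.hasProjectiveDimensionLT_of_ge _ (d + 1) _ (by omega))
end
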